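/- The multiplication map gives an isomorphism of ℚ(r,s)-vector spaces U_{r,s}(sl_∞) ≅ U⁻_{r,s}(sl_∞) ⊗ U⁰_{r,s}(sl_∞) ⊗ U⁺_{r,s}(sl_∞) (triangular decomposition), where U⁺_{r,s}(sl_∞) (resp. U⁻_{r,s}(sl_∞)) is the subalgebra generated by all e_i (resp. all f_i) and U⁰_{r,s}(sl_∞) is the subalgebra generated by all w_i^{±1}, w_i'^{±1}. -/

import Mathlib

open scoped TensorProduct

/-! ## The two-parameter quantum group `U_{r,s}(sl_∞)` -/

/-- Generators of `U_{r,s}(sl_∞)`: `e_i, f_i, w_i^{±1}, w'_i^{±1}` for `i ∈ ℕ`. -/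
inductive QGen : Type
  | e : ℕ → QGen
  | f : ℕ → QGen
  | w : ℕ → QGen
  | winv : ℕ → QGen
  | w' : ℕ → QGen
  | w'inv : ℕ → QGen

/-- The toral generators `w_i^{±1}, w'_i^{±1}`. -/
def QGen.toral : QGen → Prop
  | QGen.w _ => True
  | QGen.winv _ => True
  | QGen.w' _ => True
  | QGen.w'inv _ => True
  | _ => False

/-- The bilinear form `⟨i,j⟩` on the root lattice: `⟨i,j⟩ = c_{ij}` for `i < j`,
`⟨i,i⟩ = 1`, and `⟨i,j⟩ = 0` for `i > j`, where `(c_{ij})` is the `A_∞` Cartan matrix. -/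
def bform (i j : ℕ) : ℤ := if i = j then 1 else if j = i + 1 then -1 else 0

section QuantumGroup

variable (K : Type) [Field K] (r s : Kˣ)

open FreeAlgebra

/-- The defining relations of `U_{r,s}(sl_∞)`. -/
inductive QRel : FreeAlgebra K QGen → FreeAlgebra K QGen → Prop
  | tcomm : ∀ a b : QGen, a.toral → b.toral →
      QRel (ι K a * ι K b) (ι K b * ι K a)
  | winv1 : ∀ i, QRel (ι K (QGen.w i) * ι K (QGen.winv i)) 1
  | winv2 : ∀ i, QRel (ι K (QGen.winv i) * ι K (QGen.w i)) 1
  | w'inv1 : ∀ i, QRel (ι K (QGen.w' i) * ι K (QGen.w'inv i)) 1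
  | w'inv2 : ∀ i, QRel (ι K (QGen.w'inv i) * ι K (QGen.w' i)) 1
  | we : ∀ i j, QRel (ι K (QGen.w i) * ι K (QGen.e j))
      ((((r ^ bform j i * s ^ (-bform i j) : Kˣ) : K)) •
        (ι K (QGen.e j) * ι K (QGen.w i)))
  | w'e : ∀ i j, QRel (ι K (QGen.w' i) * ι K (QGen.e j))
      ((((r ^ (-bform i j) * s ^ bform j i : Kˣ) : K)) •
        (ι K (QGen.e j) * ι K (QGen.w' i)))
  | wf : ∀ i j, QRel (ι K (QGen.w i) * ι K (QGen.f j))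
      ((((r ^ (-bform j i) * s ^ bform i j : Kˣ) : K)) •
        (ι K (QGen.f j) * ι K (QGen.w i)))
  | w'f : ∀ i j, QRel (ι K (QGen.w' i) * ι K (QGen.f j))
      ((((r ^ bform i j * s ^ (-bform j i) : Kˣ) : K)) •
        (ι K (QGen.f j) * ι K (QGen.w' i)))
  | ef : ∀ i j, QRel (ι K (QGen.e i) * ι K (QGen.f j))
      (ι K (QGen.f j) * ι K (QGen.e i) +
        if i = j then ((r : K) - (s : K))⁻¹ • (ι K (QGen.w i) - ι K (QGen.w' i)) else 0)
  | ee : ∀ i j, i + 1 < j ∨ j + 1 < i →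
      QRel (ι K (QGen.e i) * ι K (QGen.e j)) (ι K (QGen.e j) * ι K (QGen.e i))
  | ff : ∀ i j, i + 1 < j ∨ j + 1 < i →
      QRel (ι K (QGen.f i) * ι K (QGen.f j)) (ι K (QGen.f j) * ι K (QGen.f i))
  | serre_e1 : ∀ i, QRel
      (ι K (QGen.e i) * ι K (QGen.e i) * ι K (QGen.e (i + 1)) +
        (((r : K) * (s : K))) • (ι K (QGen.e (i + 1)) * ι K (QGen.e i) * ι K (QGen.e i)))
      ((((r : K) + (s : K))) • (ι K (QGen.e i) * ι K (QGen.e (i + 1)) * ι K (QGen.e i)))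
  | serre_e2 : ∀ i, QRel
      (ι K (QGen.e i) * ι K (QGen.e (i + 1)) * ι K (QGen.e (i + 1)) +
        (((r : K) * (s : K))) • (ι K (QGen.e (i + 1)) * ι K (QGen.e (i + 1)) * ι K (QGen.e i)))
      ((((r : K) + (s : K))) • (ι K (QGen.e (i + 1)) * ι K (QGen.e i) * ι K (QGen.e (i + 1))))
  | serre_f1 : ∀ i, QRel
      (ι K (QGen.f i) * ι K (QGen.f i) * ι K (QGen.f (i + 1)) +
        (((r : K) * (s : K))⁻¹) • (ι K (QGen.f (i + 1)) * ι K (QGen.f i) * ι K (QGen.f i)))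
      ((((r : K)⁻¹ + (s : K)⁻¹)) • (ι K (QGen.f i) * ι K (QGen.f (i + 1)) * ι K (QGen.f i)))
  | serre_f2 : ∀ i, QRel
      (ι K (QGen.f i) * ι K (QGen.f (i + 1)) * ι K (QGen.f (i + 1)) +
        (((r : K) * (s : K))⁻¹) • (ι K (QGen.f (i + 1)) * ι K (QGen.f (i + 1)) * ι K (QGen.f i)))
      ((((r : K)⁻¹ + (s : K)⁻¹)) • (ι K (QGen.f (i + 1)) * ι K (QGen.f i) * ι K (QGen.f (i + 1))))

/-- The two-parameter quantum group `U_{r,s}(sl_∞)`. -/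
abbrev UQ : Type := RingQuot (QRel K r s)

/-- The generator `e_i` of `U_{r,s}(sl_∞)`. -/
noncomputable def Ue (i : ℕ) : UQ K r s :=
  RingQuot.mkAlgHom K (QRel K r s) (ι K (QGen.e i))

/-- The generator `f_i` of `U_{r,s}(sl_∞)`. -/
noncomputable def Uf (i : ℕ) : UQ K r s :=
  RingQuot.mkAlgHom K (QRel K r s) (ι K (QGen.f i))

/-- The generator `w_i` of `U_{r,s}(sl_∞)`. -/
noncomputable def Uw (i : ℕ) : UQ K r s :=
  RingQuot.mkAlgHom K (QRel K r s) (ι K (QGen.w i))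

/-- The generator `w_i^{-1}` of `U_{r,s}(sl_∞)`. -/
noncomputable def Uwinv (i : ℕ) : UQ K r s :=
  RingQuot.mkAlgHom K (QRel K r s) (ι K (QGen.winv i))

/-- The generator `w'_i` of `U_{r,s}(sl_∞)`. -/
noncomputable def Uw' (i : ℕ) : UQ K r s :=
  RingQuot.mkAlgHom K (QRel K r s) (ι K (QGen.w' i))

/-- The generator `w'^{-1}_i` of `U_{r,s}(sl_∞)`. -/
noncomputable def Uw'inv (i : ℕ) : UQ K r s :=
  RingQuot.mkAlgHom K (QRel K r s) (ι K (QGen.w'inv i))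

end QuantumGroup

section HopfData

variable (K : Type) [CommSemiring K] (A : Type) [Semiring A] [Algebra K A]

/-- Structure maps for a Hopf algebra structure on an algebra `A`:
a comultiplication, a counit and an antipode. -/
structure HopfData : Type _ where
  comul : A →ₗ[K] A ⊗[K] A
  counit : A →ₗ[K] K
  antipode : A →ₗ[K] A

variable {K A}

/-- The given structure maps make the algebra `A` into a Hopf algebra: the comultiplication
is coassociative and counital, comultiplication and counit are algebra morphisms, and the
antipode axioms hold. -/
def HopfData.IsHopf (D : HopfData K A) : Prop :=
  ((TensorProduct.assoc K A A A).toLinearMap ∘ₗ D.comul.rTensor A ∘ₗ D.comul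
      = D.comul.lTensor A ∘ₗ D.comul) ∧
  (D.counit.rTensor A ∘ₗ D.comul = TensorProduct.mk K K A 1) ∧
  (D.counit.lTensor A ∘ₗ D.comul = (TensorProduct.mk K A K).flip 1) ∧
  (D.comul 1 = 1) ∧ (∀ x y : A, D.comul (x * y) = D.comul x * D.comul y) ∧
  (D.counit 1 = 1) ∧ (∀ x y : A, D.counit (x * y) = D.counit x * D.counit y) ∧
  (LinearMap.mul' K A ∘ₗ D.antipode.rTensor A ∘ₗ D.comul
      = (Algebra.linearMap K A) ∘ₗ D.counit) ∧
  (LinearMap.mul' K A ∘ₗ D.antipode.lTensor A ∘ₗ D.comul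
      = (Algebra.linearMap K A) ∘ₗ D.counit)

end HopfData

/-! ## The field `ℚ(r,s)` -/

/-- The field `ℚ(r,s)` of rational functions in the two parameters `r, s`. -/
abbrev KK : Type := FractionRing (MvPolynomial (Fin 2) ℚ)

/-- The parameter `r`, as a unit of `ℚ(r,s)`. -/
noncomputable def rU : KKˣ :=
  Units.mk0 (algebraMap (MvPolynomial (Fin 2) ℚ) KK (MvPolynomial.X 0)) (by
    simp only [ne_eq, IsFractionRing.to_map_eq_zero_iff]
    exact MvPolynomial.X_ne_zero (0 : Fin 2))

/-- The parameter `s`, as a unit of `ℚ(r,s)`. -/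
noncomputable def sU : KKˣ :=
  Units.mk0 (algebraMap (MvPolynomial (Fin 2) ℚ) KK (MvPolynomial.X 1)) (by
    simp only [ne_eq, IsFractionRing.to_map_eq_zero_iff]
    exact MvPolynomial.X_ne_zero (1 : Fin 2))

noncomputable section

/-! ## Factorisation of an algebra by Ore-type commutation rules -/

section Ore

variable {K A C U X : Type*} [CommRing K] [Ring A] [Algebra K A] [Ring C] [Algebra K C]
  [Ring U] [Algebra K U]

/-- Left multiplication by `A` on `A ⊗ C`. -/
def leftMul (K A C : Type*) [CommRing K] [Ring A] [Algebra K A] [Ring C] [Algebra K C] :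
    A →ₐ[K] Module.End K (A ⊗[K] C) :=
  (Algebra.lmul K (A ⊗[K] C)).comp Algebra.TensorProduct.includeLeft

@[simp]
theorem leftMul_tmul (a a' : A) (c : C) :
    leftMul K A C a (a' ⊗ₜ[K] c) = (a * a') ⊗ₜ c := by
  simp [leftMul]

/-- The operator `a ⊗ c' ↦ τ a ⊗ c c' + δ a ⊗ c'` on `A ⊗ C`, modelling left multiplication by
an element `c` subject to the rule `c a = τ a c + δ a`. -/
def oreOp (τ : A →ₐ[K] A) (δ : A →ₗ[K] A) (c : C) : Module.End K (A ⊗[K] C) :=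
  TensorProduct.map τ.toLinearMap (LinearMap.mulLeft K c) + TensorProduct.map δ LinearMap.id

@[simp]
theorem oreOp_tmul (τ : A →ₐ[K] A) (δ : A →ₗ[K] A) (c : C) (a : A) (c' : C) :
    oreOp τ δ c (a ⊗ₜ[K] c') = τ a ⊗ₜ (c * c') + δ a ⊗ₜ c' := by
  simp [oreOp]

/-- `δ` is a left `τ`-derivation. -/
def IsSkewDer (τ : A →ₐ[K] A) (δ : A →ₗ[K] A) : Prop :=
  ∀ a b, δ (a * b) = τ a * δ b + δ a * b

theorem IsSkewDer.map_one {τ : A →ₐ[K] A} {δ : A →ₗ[K] A} (h : IsSkewDer τ δ) : δ 1 = 0 := by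
  simpa using h 1 1

theorem IsSkewDer.oreOp_mul_leftMul {τ : A →ₐ[K] A} {δ : A →ₗ[K] A} (h : IsSkewDer τ δ)
    (c : C) (a : A) :
    oreOp τ δ c * leftMul K A C a =
      leftMul K A C (τ a) * oreOp τ δ c + leftMul K A C (δ a) := by
  refine TensorProduct.ext' fun a' c' => ?_
  simp [h a a', TensorProduct.add_tmul, add_assoc]

theorem IsSkewDer.oreOp_one_tmul {τ : A →ₐ[K] A} {δ : A →ₗ[K] A} (h : IsSkewDer τ δ)
    (c c' : C) : oreOp τ δ c ((1 : A) ⊗ₜ[K] c') = 1 ⊗ₜ (c * c') := by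
  simp [h.map_one]

/-- The map `a ⊗ c ↦ i a * j c`. -/
def mulMap (i : A →ₐ[K] U) (j : C →ₐ[K] U) : A ⊗[K] C →ₗ[K] U :=
  LinearMap.mul' K U ∘ₗ TensorProduct.map i.toLinearMap j.toLinearMap

@[simp]
theorem mulMap_tmul (i : A →ₐ[K] U) (j : C →ₐ[K] U) (a : A) (c : C) :
    mulMap i j (a ⊗ₜ[K] c) = i a * j c := by
  simp [mulMap]

/-- Commutation rules between algebra generators extend to all of `A`. -/
theorem skew_commutation {τ : A →ₐ[K] A} {δ : A →ₗ[K] A} (h : IsSkewDer τ δ)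
    (i : A →ₐ[K] U) (u : U) {S : Set A} (hS : Algebra.adjoin K S = ⊤)
    (hu : ∀ a ∈ S, u * i a = i (τ a) * u + i (δ a)) (a : A) :
    u * i a = i (τ a) * u + i (δ a) := by
  have ha : a ∈ Algebra.adjoin K S := hS ▸ Algebra.mem_top
  induction ha using Algebra.adjoin_induction with
  | mem x hx => exact hu x hx
  | algebraMap k =>
    have : δ (algebraMap K A k) = 0 := by
      rw [Algebra.algebraMap_eq_smul_one, map_smul, h.map_one, smul_zero]
    simp [this, Algebra.commutes]
  | add x y _ _ hx hy => simp only [map_add, mul_add, add_mul, hx, hy]; abel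
  | mul x y _ _ hx hy =>
    rw [h x y, map_mul, map_mul, map_mul, map_add, map_mul, map_mul, ← mul_assoc, hx, add_mul,
      mul_assoc, hy, mul_add]
    simp only [mul_assoc, add_assoc]

/-- If `U` is generated by the images of `A` and `C`, whose generators satisfy Ore-type
commutation rules, and `U` acts on `A ⊗ C` by the model operators, then multiplication
`A ⊗ C → U` is bijective. -/
theorem mulMap_bijective (i : A →ₐ[K] U) (j : C →ₐ[K] U) (c : X → C)
    (τ : X → A →ₐ[K] A) (δ : X → A →ₗ[K] A) (h : ∀ x, IsSkewDer (τ x) (δ x))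
    {S : Set A} (hS : Algebra.adjoin K S = ⊤)
    (hu : ∀ x, ∀ a ∈ S, j (c x) * i a = i (τ x a) * j (c x) + i (δ x a))
    (hc : Algebra.adjoin K (Set.range c) = ⊤)
    (hU : Algebra.adjoin K (Set.range i ∪ Set.range (j ∘ c)) = ⊤)
    (ρ : U →ₐ[K] Module.End K (A ⊗[K] C)) (hρi : ∀ a, ρ (i a) = leftMul K A C a)
    (hρj : ∀ x, ρ (j (c x)) = oreOp (τ x) (δ x) (c x)) :
    Function.Bijective (mulMap i j) := by
  have hρ : ∀ b b' : C, ρ (j b) ((1 : A) ⊗ₜ[K] b') = 1 ⊗ₜ (b * b') := by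
    intro b
    have hb : b ∈ Algebra.adjoin K (Set.range c) := hc ▸ Algebra.mem_top
    induction hb using Algebra.adjoin_induction with
    | mem x hx =>
      obtain ⟨x, rfl⟩ := hx
      intro b'
      rw [hρj, (h x).oreOp_one_tmul]
    | algebraMap k =>
      intro b'
      simp [Algebra.algebraMap_eq_smul_one]
    | add x y _ _ hx hy =>
      intro b'
      simp [hx, hy, add_mul, TensorProduct.tmul_add]
    | mul x y _ _ hx hy =>
      intro b'
      simp [hx, hy, mul_assoc]
  constructor
  · refine Function.LeftInverse.injective (g := fun u => ρ u (1 ⊗ₜ 1)) fun m => ?_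
    induction m using TensorProduct.induction_on with
    | zero => simp
    | tmul a b => simp [hρi, hρ]
    | add x y hx hy => simpa using congrArg₂ (· + ·) hx hy
  · have key : ∀ (u : U) (m : A ⊗[K] C), mulMap i j (ρ u m) = u * mulMap i j m := by
      intro u
      have hu' : u ∈ Algebra.adjoin K (Set.range i ∪ Set.range (j ∘ c)) := hU ▸ Algebra.mem_top
      induction hu' using Algebra.adjoin_induction with
      | mem x hx =>
        intro m
        induction m using TensorProduct.induction_on with
        | zero => simp
        | add m n hm hn => simp [hm, hn, mul_add]
        | tmul a b =>
          rcases hx with ⟨a', rfl⟩ | ⟨x, rfl⟩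
          · simp [hρi, mul_assoc]
          · simp only [Function.comp_apply, hρj, oreOp_tmul, map_add, mulMap_tmul, map_mul]
            rw [← mul_assoc (j (c x)), skew_commutation (h x) i _ hS (hu x), add_mul, mul_assoc]
      | algebraMap k => simp [Algebra.algebraMap_eq_smul_one]
      | add x y _ _ hx hy => simp [hx, hy, add_mul]
      | mul x y _ _ hx hy => simp [hx, hy, mul_assoc]
    intro u
    refine ⟨ρ u (1 ⊗ₜ 1), ?_⟩
    rw [key, mulMap_tmul, map_one, map_one, mul_one, mul_one]

/-- The upper left entry of an upper triangular matrix representation, as an endomorphism. -/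
def matrixEndo (θ : A →ₐ[K] Matrix (Fin 2) (Fin 2) A) (h : ∀ a, θ a 1 0 = 0) : A →ₐ[K] A where
  toFun a := θ a 0 0
  map_one' := by simp
  map_mul' a b := by simp [Matrix.mul_apply, h]
  map_zero' := by simp
  map_add' a b := by simp
  commutes' k := by simp [Matrix.algebraMap_matrix_apply]

/-- The upper right entry of a matrix representation, as a linear map. -/
def matrixDer (θ : A →ₐ[K] Matrix (Fin 2) (Fin 2) A) : A →ₗ[K] A where
  toFun a := θ a 0 1
  map_add' a b := by simp
  map_smul' k a := by simp

theorem isSkewDer_matrixDer (θ : A →ₐ[K] Matrix (Fin 2) (Fin 2) A) (h : ∀ a, θ a 1 0 = 0)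
    (h' : ∀ a, θ a 1 1 = a) : IsSkewDer (matrixEndo θ h) (matrixDer θ) := by
  intro a b
  simp [matrixEndo, matrixDer, Matrix.mul_apply, h']

theorem matrix_lower_row (θ : A →ₐ[K] Matrix (Fin 2) (Fin 2) A) {S : Set A}
    (hS : Algebra.adjoin K S = ⊤) (h : ∀ a ∈ S, θ a 1 0 = 0 ∧ θ a 1 1 = a) (a : A) :
    θ a 1 0 = 0 ∧ θ a 1 1 = a := by
  have ha : a ∈ Algebra.adjoin K S := hS ▸ Algebra.mem_top
  induction ha using Algebra.adjoin_induction with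
  | mem x hx => exact h x hx
  | algebraMap k => simp [Matrix.algebraMap_matrix_apply]
  | add x y _ _ hx hy => simp [hx, hy]
  | mul x y _ _ hx hy => simp [Matrix.mul_apply, hx, hy]

end Ore

/-! ## Algebras given by generators and relations -/

section Presented

open FreeAlgebra

variable {K X : Type*} [CommRing K]

/-- The algebra presented by generators `X` and relations `R`. -/
def Presented (R : FreeAlgebra K X → FreeAlgebra K X → Prop) : Type _ := RingQuot R

namespace Presented

variable {R : FreeAlgebra K X → FreeAlgebra K X → Prop}

instance : Ring (Presented R) := inferInstanceAs (Ring (RingQuot R))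

instance : Algebra K (Presented R) := inferInstanceAs (Algebra K (RingQuot R))

variable (R) in
/-- The identification with `RingQuot`. -/
def equivRingQuot : Presented R ≃ₐ[K] RingQuot R := AlgEquiv.refl

variable (R) in
/-- The generators of a presented algebra. -/
def of (x : X) : Presented R := (equivRingQuot R).symm (RingQuot.mkAlgHom K R (ι K x))

@[simp]
theorem equivRingQuot_of (x : X) :
    equivRingQuot R (of R x) = RingQuot.mkAlgHom K R (ι K x) :=
  AlgEquiv.apply_symm_apply _ _

theorem lift_of (u : FreeAlgebra K X) :
    FreeAlgebra.lift K (of R) u = (equivRingQuot R).symm (RingQuot.mkAlgHom K R u) := by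
  have : FreeAlgebra.lift K (of R) =
      (equivRingQuot R).symm.toAlgHom.comp (RingQuot.mkAlgHom K R) := by
    ext; simp [of]
  rw [this]; rfl

theorem rel ⦃u v : FreeAlgebra K X⦄ (h : R u v) :
    FreeAlgebra.lift K (of R) u = FreeAlgebra.lift K (of R) v := by
  rw [lift_of, lift_of, RingQuot.mkAlgHom_rel K h]

theorem adjoin_of : Algebra.adjoin K (Set.range (of R)) = ⊤ := by
  rw [Algebra.adjoin_range_eq_range_freeAlgebra_lift, AlgHom.range_eq_top]
  intro y
  obtain ⟨u, hu⟩ := RingQuot.mkAlgHom_surjective K R (equivRingQuot R y)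
  exact ⟨u, by rw [lift_of, hu, AlgEquiv.symm_apply_apply]⟩

variable {A : Type*} [Ring A] [Algebra K A] {F : X → A}

/-- The universal property of a presented algebra. -/
def lift (hF : ∀ ⦃u v⦄, R u v → FreeAlgebra.lift K F u = FreeAlgebra.lift K F v) :
    Presented R →ₐ[K] A :=
  (RingQuot.liftAlgHom K ⟨FreeAlgebra.lift K F, hF⟩).comp (equivRingQuot R).toAlgHom

@[simp]
theorem lift_apply_of (hF : ∀ ⦃u v⦄, R u v → FreeAlgebra.lift K F u = FreeAlgebra.lift K F v)
    (x : X) : lift hF (of R x) = F x := by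
  simp [lift]

end Presented

end Presented

/-! ## Serre relations -/

section Serre

open FreeAlgebra

variable {K : Type*} [CommRing K]

/-- The Serre relations of type `A_∞` with coefficients `a`, `b`. -/
inductive SerreRel (a b : K) : FreeAlgebra K ℕ → FreeAlgebra K ℕ → Prop
  | far : ∀ i j, i + 1 < j ∨ j + 1 < i → SerreRel a b (ι K i * ι K j) (ι K j * ι K i)
  | left : ∀ i, SerreRel a b
      (ι K i * ι K i * ι K (i + 1) + a • (ι K (i + 1) * ι K i * ι K i))
      (b • (ι K i * ι K (i + 1) * ι K i))
  | right : ∀ i, SerreRel a b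
      (ι K i * ι K (i + 1) * ι K (i + 1) + a • (ι K (i + 1) * ι K (i + 1) * ι K i))
      (b • (ι K (i + 1) * ι K i * ι K (i + 1)))

/-- The family `x` satisfies the Serre relations. -/
def IsSerre {A : Type*} [Ring A] [Algebra K A] (a b : K) (x : ℕ → A) : Prop :=
  ∀ ⦃u v⦄, SerreRel a b u v → FreeAlgebra.lift K x u = FreeAlgebra.lift K x v

/-- The algebra presented by the Serre relations. -/
abbrev SerreAlg (a b : K) : Type _ := Presented (SerreRel a b)

/-- The generators of `SerreAlg`. -/
def SerreAlg.gen (a b : K) (i : ℕ) : SerreAlg a b := Presented.of (SerreRel a b) i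

variable {A A' : Type*} [Ring A] [Algebra K A] [Ring A'] [Algebra K A'] {a b : K} {x : ℕ → A}

theorem SerreAlg.isSerre_gen : IsSerre a b (SerreAlg.gen a b) :=
  fun _ _ h => Presented.rel h

theorem SerreAlg.adjoin_gen : Algebra.adjoin K (Set.range (SerreAlg.gen a b)) = ⊤ :=
  Presented.adjoin_of

/-- The universal property of `SerreAlg`. -/
def IsSerre.lift (hx : IsSerre a b x) : SerreAlg a b →ₐ[K] A :=
  Presented.lift hx

@[simp]
theorem IsSerre.lift_gen (hx : IsSerre a b x) (i : ℕ) : hx.lift (SerreAlg.gen a b i) = x i :=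
  Presented.lift_apply_of hx i

theorem IsSerre.map (hx : IsSerre a b x) (g : A →ₐ[K] A') : IsSerre a b fun i => g (x i) := by
  have : FreeAlgebra.lift K (fun i => g (x i)) = g.comp (FreeAlgebra.lift K x) := by
    ext; simp
  intro u v h
  rw [this, AlgHom.comp_apply, AlgHom.comp_apply, hx h]

/-- The Serre relations are homogeneous. -/
theorem IsSerre.smul (hx : IsSerre a b x) (c : ℕ → K) : IsSerre a b fun i => c i • x i := by
  intro u v h
  have hrel := hx h
  cases h with
  | far i j _ =>
    simp only [map_mul, lift_ι_apply, smul_mul_smul_comm] at hrel ⊢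
    rw [hrel, mul_comm]
  | left i =>
    simp only [map_mul, map_add, map_smul, lift_ι_apply, smul_mul_smul_comm] at hrel ⊢
    linear_combination (norm := module) (c i * c i * c (i + 1)) • hrel
  | right i =>
    simp only [map_mul, map_add, map_smul, lift_ι_apply, smul_mul_smul_comm] at hrel ⊢
    linear_combination (norm := module) (c i * c (i + 1) * c (i + 1)) • hrel

/-- The matrices `x_i + ε D_i`, where `D_k = D` and `D_i = 0` for `i ≠ k`. -/
def dualMatrix (x : ℕ → A) (k : ℕ) (D : A) (i : ℕ) : Matrix (Fin 2) (Fin 2) A :=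
  !![x i, if i = k then D else 0; 0, x i]

theorem lift_dualMatrix (x : ℕ → A) (k : ℕ) (D : A) (u : FreeAlgebra K ℕ) :
    FreeAlgebra.lift K (dualMatrix x k D) u 0 0 = FreeAlgebra.lift K x u ∧
    FreeAlgebra.lift K (dualMatrix x k D) u 1 0 = 0 ∧
    FreeAlgebra.lift K (dualMatrix x k D) u 1 1 = FreeAlgebra.lift K x u := by
  induction u using FreeAlgebra.induction with
  | grade0 k => simp [Matrix.algebraMap_matrix_apply]
  | grade1 i => simp [dualMatrix]
  | mul u v hu hv => simp [Matrix.mul_apply, hu, hv]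
  | add u v hu hv => simp [hu, hv]

/-- The derivation of the free algebra with `x_k ↦ D` preserves the Serre relations. -/
def SerreDer (a b : K) (x : ℕ → A) (k : ℕ) (D : A) : Prop :=
  ∀ ⦃u v⦄, SerreRel a b u v →
    FreeAlgebra.lift K (dualMatrix x k D) u 0 1 = FreeAlgebra.lift K (dualMatrix x k D) v 0 1

theorem SerreDer.isSerre_dualMatrix {k : ℕ} {D : A} (h : SerreDer a b x k D)
    (hx : IsSerre a b x) : IsSerre a b (dualMatrix x k D) := by
  intro u v huv
  obtain ⟨h1, h2, h3⟩ := lift_dualMatrix x k D u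
  obtain ⟨h1', h2', h3'⟩ := lift_dualMatrix x k D v
  ext i j
  fin_cases i <;> fin_cases j
  · simpa [h1, h1'] using hx huv
  · exact h huv
  · simp [h2, h2']
  · simpa [h3, h3'] using hx huv

theorem SerreDer.commute_sub {k : ℕ} {D F : A} (h : SerreDer a b x k D)
    (hF : ∀ i, x i * F = F * x i + if i = k then D else 0) ⦃u v⦄ (huv : SerreRel a b u v) :
    (FreeAlgebra.lift K x u - FreeAlgebra.lift K x v) * F =
      F * (FreeAlgebra.lift K x u - FreeAlgebra.lift K x v) := by
  have key : ∀ u : FreeAlgebra K ℕ, FreeAlgebra.lift K x u * F =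
      F * FreeAlgebra.lift K x u + FreeAlgebra.lift K (dualMatrix x k D) u 0 1 := by
    intro u
    induction u using FreeAlgebra.induction with
    | grade0 k => simp [Matrix.algebraMap_matrix_apply, Algebra.commutes]
    | grade1 i => simp [dualMatrix, hF]
    | mul u v hu hv =>
      simp only [map_mul, Matrix.mul_apply, Fin.sum_univ_two, (lift_dualMatrix x k D u).1,
        (lift_dualMatrix x k D v).2.2]
      rw [mul_assoc, hv, mul_add, ← mul_assoc, hu, add_mul, mul_assoc]
      abel
    | add u v hu hv => simp only [map_add, add_mul, mul_add, hu, hv, Matrix.add_apply]; abel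
  rw [sub_mul, mul_sub, key, key, h huv]
  abel

/-- Numerical conditions on a weight matrix `c` under which an element `w` with
`w x_j = c_{kj} x_j w` yields a derivation `x_k ↦ w` compatible with the Serre relations. -/
structure SerreWeight (a b : K) (c : ℕ → ℕ → K) : Prop where
  far : ∀ i j, i + 1 < j ∨ j + 1 < i → c i j = 1
  left_fst : ∀ i, c i (i + 1) * (c i i + 1) = b
  left_fst' : ∀ i, a * (c i i + 1) = b * (c i i * c i (i + 1))
  left_snd : ∀ i, 1 + a * (c (i + 1) i * c (i + 1) i) = b * c (i + 1) i
  right_fst : ∀ i, c i (i + 1) * c i (i + 1) + a = b * c i (i + 1)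
  right_snd : ∀ i, c (i + 1) (i + 1) + 1 = b * (c (i + 1) i * c (i + 1) (i + 1))
  right_snd' : ∀ i, a * (c (i + 1) i * (c (i + 1) (i + 1) + 1)) = b

theorem SerreWeight.serreDer {c : ℕ → ℕ → K} (hc : SerreWeight a b c) {k : ℕ} {w : A}
    (hw : ∀ j, w * x j = c k j • (x j * w)) : SerreDer a b x k w := by
  intro u v h
  cases h with
  | far i j hij =>
    rcases eq_or_ne i k with rfl | hi
    · have hj : j ≠ i := by omega
      simp [dualMatrix, Matrix.mul_apply, hj, hw, hc.far i j hij]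
    · rcases eq_or_ne j k with rfl | hj
      · simp [dualMatrix, Matrix.mul_apply, hi, hw, hc.far j i hij.symm]
      · simp [dualMatrix, hi, hj]
  | left i =>
    rcases eq_or_ne i k with rfl | hi
    · simp only [dualMatrix, Matrix.mul_apply, Matrix.add_apply, Matrix.smul_apply, map_mul,
        map_add, map_smul, lift_ι_apply, Fin.sum_univ_two]
      simp [hw, mul_assoc, add_mul]
      linear_combination (norm := module) hc.left_fst i • (x i * (x (i + 1) * w)) +
        hc.left_fst' i • (x (i + 1) * (x i * w))
    · rcases eq_or_ne (i + 1) k with rfl | hj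
      · simp only [dualMatrix, Matrix.mul_apply, Matrix.add_apply, Matrix.smul_apply, map_mul,
          map_add, map_smul, lift_ι_apply, Fin.sum_univ_two]
        simp [hw, mul_assoc]
        linear_combination (norm := module) hc.left_snd i • (x i * (x i * w))
      · simp [dualMatrix, hi, hj]
  | right i =>
    rcases eq_or_ne i k with rfl | hi
    · simp only [dualMatrix, Matrix.mul_apply, Matrix.add_apply, Matrix.smul_apply, map_mul,
        map_add, map_smul, lift_ι_apply, Fin.sum_univ_two]
      simp [hw, mul_assoc]
      linear_combination (norm := module) hc.right_fst i • (x (i + 1) * (x (i + 1) * w))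
    · rcases eq_or_ne (i + 1) k with rfl | hj
      · simp only [dualMatrix, Matrix.mul_apply, Matrix.add_apply, Matrix.smul_apply, map_mul,
          map_add, map_smul, lift_ι_apply, Fin.sum_univ_two]
        simp [hw, mul_assoc, add_mul]
        linear_combination (norm := module) hc.right_snd i • (x i * (x (i + 1) * w)) +
          hc.right_snd' i • (x (i + 1) * (x i * w))
      · simp [dualMatrix, hi, hj]

theorem lift_dualMatrix_linear (x : ℕ → A) (k : ℕ) (κ : K) (D D' : A) (u : FreeAlgebra K ℕ) :
    FreeAlgebra.lift K (dualMatrix x k (κ • (D - D'))) u 0 1 =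
      κ • (FreeAlgebra.lift K (dualMatrix x k D) u 0 1 -
        FreeAlgebra.lift K (dualMatrix x k D') u 0 1) := by
  induction u using FreeAlgebra.induction with
  | grade0 k => simp [Matrix.algebraMap_matrix_apply]
  | grade1 i =>
    by_cases h : i = k <;> simp [dualMatrix, h]
  | mul u v hu hv =>
    simp only [map_mul, Matrix.mul_apply, Fin.sum_univ_two, lift_dualMatrix, hu, hv]
    simp only [mul_smul_comm, smul_mul_assoc, mul_sub, sub_mul]
    module
  | add u v hu hv =>
    simp only [map_add, Matrix.add_apply, hu, hv]
    module

theorem SerreDer.smul_sub {k : ℕ} {D D' : A} (h : SerreDer a b x k D) (h' : SerreDer a b x k D')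
    (κ : K) : SerreDer a b x k (κ • (D - D')) := by
  intro u v huv
  rw [lift_dualMatrix_linear, lift_dualMatrix_linear, h huv, h' huv]

end Serre

/-! ## The torus and the Borel algebra -/

/-- Generators of the torus: two families of invertible elements. -/
inductive TorGen : Type
  | pos : Bool → ℕ → TorGen
  | neg : Bool → ℕ → TorGen

section Torus

open FreeAlgebra

/-- The relations of the torus. -/
inductive TorRel (K : Type*) [CommRing K] : FreeAlgebra K TorGen → FreeAlgebra K TorGen → Prop
  | comm : ∀ g h, TorRel K (ι K g * ι K h) (ι K h * ι K g)
  | inv : ∀ p i, TorRel K (ι K (TorGen.pos p i) * ι K (TorGen.neg p i)) 1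

/-- The family `t` satisfies the relations of the torus. -/
structure IsTor {A : Type*} [Ring A] (t : TorGen → A) : Prop where
  comm : ∀ g h, t g * t h = t h * t g
  inv : ∀ p i, t (TorGen.pos p i) * t (TorGen.neg p i) = 1

variable (K : Type*) [CommRing K]

/-- The algebra presented by the relations of the torus. -/
abbrev TorAlg : Type _ := Presented (TorRel K)

/-- The generators of `TorAlg`. -/
def TorAlg.gen (g : TorGen) : TorAlg K := Presented.of (TorRel K) g

variable {K} {A A' : Type*} [Ring A] [Algebra K A] [Ring A'] [Algebra K A'] {t : TorGen → A}

theorem TorAlg.isTor_gen : IsTor (TorAlg.gen K) where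
  comm g h := by
    simpa only [map_mul, lift_ι_apply, TorAlg.gen] using Presented.rel (TorRel.comm (K := K) g h)
  inv p i := by
    simpa only [map_mul, map_one, lift_ι_apply, TorAlg.gen] using
      Presented.rel (TorRel.inv (K := K) p i)

theorem TorAlg.adjoin_gen : Algebra.adjoin K (Set.range (TorAlg.gen K)) = ⊤ :=
  Presented.adjoin_of

theorem IsTor.lift_rel (ht : IsTor t) ⦃u v⦄ (h : TorRel K u v) :
    FreeAlgebra.lift K t u = FreeAlgebra.lift K t v := by
  cases h with
  | comm g h => simpa using ht.comm g h
  | inv p i => simpa using ht.inv p i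

variable (K) in
/-- The universal property of `TorAlg`. -/
def IsTor.lift (ht : IsTor t) : TorAlg K →ₐ[K] A :=
  Presented.lift ht.lift_rel

@[simp]
theorem IsTor.lift_gen (ht : IsTor t) (g : TorGen) : ht.lift K (TorAlg.gen K g) = t g := by
  simp [IsTor.lift, TorAlg.gen]

theorem IsTor.map (ht : IsTor t) (φ : A →ₐ[K] A') : IsTor fun g => φ (t g) where
  comm g h := by rw [← map_mul, ht.comm, map_mul]
  inv p i := by rw [← map_mul, ht.inv, map_one]

end Torus

section Borel

open FreeAlgebra

variable {K : Type*} [CommRing K]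

/-- The relations of the algebra generated by a Serre family and a torus acting on it with
weights `φ`. -/
inductive BorelRel (a b : K) (φ : TorGen → ℕ → Kˣ) :
    FreeAlgebra K (ℕ ⊕ TorGen) → FreeAlgebra K (ℕ ⊕ TorGen) → Prop
  | serre : ∀ u v, SerreRel a b u v → BorelRel a b φ
      (FreeAlgebra.lift K (ι K ∘ Sum.inl) u) (FreeAlgebra.lift K (ι K ∘ Sum.inl) v)
  | tor : ∀ u v, TorRel K u v → BorelRel a b φ
      (FreeAlgebra.lift K (ι K ∘ Sum.inr) u) (FreeAlgebra.lift K (ι K ∘ Sum.inr) v)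
  | cross : ∀ g j, BorelRel a b φ (ι K (Sum.inr g) * ι K (Sum.inl j))
      ((φ g j : K) • (ι K (Sum.inl j) * ι K (Sum.inr g)))

/-- The families `x`, `t` satisfy the relations `BorelRel`. -/
structure IsBorel {A : Type*} [Ring A] [Algebra K A] (a b : K) (φ : TorGen → ℕ → Kˣ)
    (x : ℕ → A) (t : TorGen → A) : Prop where
  serre : IsSerre a b x
  tor : IsTor t
  cross : ∀ g j, t g * x j = (φ g j : K) • (x j * t g)

/-- The algebra presented by `BorelRel`. -/
abbrev BorelAlg (a b : K) (φ : TorGen → ℕ → Kˣ) : Type _ := Presented (BorelRel a b φ)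

/-- The Serre generators of `BorelAlg`. -/
def BorelAlg.x (a b : K) (φ : TorGen → ℕ → Kˣ) (i : ℕ) : BorelAlg a b φ :=
  Presented.of (BorelRel a b φ) (Sum.inl i)

/-- The toral generators of `BorelAlg`. -/
def BorelAlg.t (a b : K) (φ : TorGen → ℕ → Kˣ) (g : TorGen) : BorelAlg a b φ :=
  Presented.of (BorelRel a b φ) (Sum.inr g)

variable {A A' : Type*} [Ring A] [Algebra K A] [Ring A'] [Algebra K A']
  {a b : K} {φ : TorGen → ℕ → Kˣ} {x : ℕ → A} {t : TorGen → A}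

theorem lift_lift_comp {X Y : Type*} (F : Y → A) (h : X → Y) (u : FreeAlgebra K X) :
    FreeAlgebra.lift K F (FreeAlgebra.lift K (ι K ∘ h) u) = FreeAlgebra.lift K (F ∘ h) u := by
  have : (FreeAlgebra.lift K F).comp (FreeAlgebra.lift K (ι K ∘ h)) =
      FreeAlgebra.lift K (F ∘ h) := by
    ext; simp
  rw [← this, AlgHom.comp_apply]

theorem BorelAlg.isBorel : IsBorel a b φ (BorelAlg.x a b φ) (BorelAlg.t a b φ) where
  serre u v h := by
    have := Presented.rel (BorelRel.serre (φ := φ) u v h)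
    rwa [lift_lift_comp, lift_lift_comp] at this
  tor :=
    { comm := fun g h => by
        have := Presented.rel (BorelRel.tor (a := a) (b := b) (φ := φ) _ _
          (TorRel.comm g h))
        simpa [BorelAlg.t] using this
      inv := fun p i => by
        have := Presented.rel (BorelRel.tor (a := a) (b := b) (φ := φ) _ _
          (TorRel.inv p i))
        simpa [BorelAlg.t] using this }
  cross g j := by
    have := Presented.rel (BorelRel.cross (a := a) (b := b) (φ := φ) g j)
    simpa [BorelAlg.t, BorelAlg.x] using this

theorem BorelAlg.adjoin_gen :
    Algebra.adjoin K (Set.range (BorelAlg.x a b φ) ∪ Set.range (BorelAlg.t a b φ)) = ⊤ := by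
  rw [← Presented.adjoin_of (R := BorelRel a b φ)]
  congr 1
  ext y
  simp [BorelAlg.x, BorelAlg.t]

/-- The universal property of `BorelAlg`. -/
def IsBorel.lift (h : IsBorel a b φ x t) : BorelAlg a b φ →ₐ[K] A :=
  Presented.lift (F := Sum.elim x t) (by
    rintro _ _ (⟨u, v, huv⟩ | ⟨u, v, huv⟩ | ⟨g, j⟩)
    · simpa [lift_lift_comp] using h.serre huv
    · simpa [lift_lift_comp] using h.tor.lift_rel huv
    · simpa using h.cross g j)

@[simp]
theorem IsBorel.lift_x (h : IsBorel a b φ x t) (i : ℕ) : h.lift (BorelAlg.x a b φ i) = x i := by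
  simp [IsBorel.lift, BorelAlg.x]

@[simp]
theorem IsBorel.lift_t (h : IsBorel a b φ x t) (g : TorGen) :
    h.lift (BorelAlg.t a b φ g) = t g := by
  simp [IsBorel.lift, BorelAlg.t]

theorem IsBorel.map (h : IsBorel a b φ x t) (g : A →ₐ[K] A') :
    IsBorel a b φ (fun i => g (x i)) (fun i => g (t i)) where
  serre := h.serre.map g
  tor := h.tor.map g
  cross k j := by rw [← map_mul, h.cross, map_smul, map_mul]

/-- The torus acts on `SerreAlg` by rescaling the generators. -/
def scaleHom (a b : K) (φ : TorGen → ℕ → Kˣ) (g : TorGen) : SerreAlg a b →ₐ[K] SerreAlg a b :=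
  (SerreAlg.isSerre_gen.smul fun j => (φ g j : K)).lift

@[simp]
theorem scaleHom_gen (g : TorGen) (j : ℕ) :
    scaleHom a b φ g (SerreAlg.gen a b j) = (φ g j : K) • SerreAlg.gen a b j := by
  simp [scaleHom]

theorem SerreAlg.algHom_ext {f g : SerreAlg a b →ₐ[K] A}
    (h : ∀ i, f (SerreAlg.gen a b i) = g (SerreAlg.gen a b i)) : f = g :=
  AlgHom.ext_of_adjoin_eq_top SerreAlg.adjoin_gen (by rintro _ ⟨i, rfl⟩; exact h i)

theorem isSkewDer_zero (τ : A →ₐ[K] A) : IsSkewDer τ (0 : A →ₗ[K] A) := fun a b => by simp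

/-- Multiplication of the Serre part with the toral part is bijective onto `BorelAlg`. -/
theorem BorelAlg.mulMap_bijective
    (hφ : ∀ p i j, φ (TorGen.pos p i) j * φ (TorGen.neg p i) j = 1) :
    Function.Bijective (mulMap (BorelAlg.isBorel (φ := φ)).serre.lift
      ((BorelAlg.isBorel (a := a) (b := b) (φ := φ)).tor.lift K)) := by
  have hB : IsBorel a b φ
      (fun i => leftMul K (SerreAlg a b) (TorAlg K) (SerreAlg.gen a b i))
      (fun g => oreOp (scaleHom a b φ g) 0 (TorAlg.gen K g)) :=
    { serre := SerreAlg.isSerre_gen.map _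
      tor :=
        { comm := fun g h => by
            have hgh : (scaleHom a b φ g).comp (scaleHom a b φ h) =
                (scaleHom a b φ h).comp (scaleHom a b φ g) :=
              SerreAlg.algHom_ext fun i => by simp [smul_smul, mul_comm]
            refine TensorProduct.ext' fun y z => ?_
            have := DFunLike.congr_fun hgh y
            simp only [AlgHom.comp_apply] at this
            simp [← mul_assoc, this, TorAlg.isTor_gen.comm g h]
          inv := fun p i => by
            have hpi : (scaleHom a b φ (TorGen.pos p i)).comp
                (scaleHom a b φ (TorGen.neg p i)) = AlgHom.id K _ :=
              SerreAlg.algHom_ext fun j => by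
                simp [smul_smul, ← Units.val_mul, mul_comm (φ (TorGen.neg p i) j), hφ]
            refine TensorProduct.ext' fun y z => ?_
            have := DFunLike.congr_fun hpi y
            simp only [AlgHom.comp_apply] at this
            simp [← mul_assoc, this, TorAlg.isTor_gen.inv] }
      cross := fun g j => by
        rw [(isSkewDer_zero _).oreOp_mul_leftMul]
        simp }
  refine _root_.mulMap_bijective _ _ (TorAlg.gen K) (scaleHom a b φ) (fun _ => 0)
    (fun g => isSkewDer_zero _) SerreAlg.adjoin_gen ?_ TorAlg.adjoin_gen ?_ hB.lift ?_ ?_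
  · rintro g _ ⟨j, rfl⟩
    simp [BorelAlg.isBorel.cross]
  · rw [eq_top_iff, ← BorelAlg.adjoin_gen]
    refine Algebra.adjoin_mono (Set.union_subset_union ?_ ?_)
    · rintro _ ⟨i, rfl⟩
      exact ⟨SerreAlg.gen a b i, by simp⟩
    · rintro _ ⟨i, rfl⟩
      exact ⟨i, by simp⟩
  · intro y
    have : hB.lift.comp (BorelAlg.isBorel (φ := φ)).serre.lift =
        leftMul K (SerreAlg a b) (TorAlg K) :=
      SerreAlg.algHom_ext fun i => by simp
    exact DFunLike.congr_fun this y
  · intro g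
    simp

end Borel

/-! ## The action on `BorelAlg ⊗ SerreAlg` -/

section Action

open FreeAlgebra

variable {K : Type*} [CommRing K]

/-- Compatibility of torus weights with the Serre coefficients `a`, `b` of the family `f` and
`a'`, `b'` of the family `e`. -/
structure IsWeight (a b a' b' : K) (φ : TorGen → ℕ → Kˣ) : Prop where
  inv : ∀ p i j, φ (TorGen.pos p i) j * φ (TorGen.neg p i) j = 1
  serre_f : ∀ p, SerreWeight a b fun i j => (φ (TorGen.pos p i) j : K)
  serre_e : ∀ p, SerreWeight a' b' fun i j => (((φ (TorGen.pos p i) j)⁻¹ : Kˣ) : K)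

/-- The element `κ (w_k - w'_k)` formed from a family of toral elements. -/
def torDiff {A : Type*} [Ring A] [Algebra K A] (κ : K) (t : TorGen → A) (k : ℕ) : A :=
  κ • (t (TorGen.pos false k) - t (TorGen.pos true k))

/-- The families `f`, `t`, `e` satisfy the relations of a quantum group of type `A_∞`. -/
structure IsQuantum {A : Type*} [Ring A] [Algebra K A] (a b a' b' κ : K) (φ : TorGen → ℕ → Kˣ)
    (f : ℕ → A) (t : TorGen → A) (e : ℕ → A) : Prop where
  borel : IsBorel a b φ f t
  serre : IsSerre a' b' e
  cross_t : ∀ k g, e k * t g = (φ g k : K) • (t g * e k)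
  cross_f : ∀ k j, e k * f j = f j * e k + if k = j then torDiff κ t k else 0

theorem IsQuantum.cross_t' {A : Type*} [Ring A] [Algebra K A] {a b a' b' κ : K}
    {φ : TorGen → ℕ → Kˣ} {f : ℕ → A} {t : TorGen → A} {e : ℕ → A}
    (h : IsQuantum a b a' b' κ φ f t e) (g : TorGen) (k : ℕ) :
    t g * e k = (((φ g k)⁻¹ : Kˣ) : K) • (e k * t g) := by
  simp [h.cross_t, smul_smul]

/-- The matrices representing the commutation of `e_k` with the toral generators. -/
def torMatrix (a b : K) (φ : TorGen → ℕ → Kˣ) (k : ℕ) (g : TorGen) :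
    Matrix (Fin 2) (Fin 2) (BorelAlg a b φ) :=
  !![(φ g k : K) • BorelAlg.t a b φ g, 0; 0, BorelAlg.t a b φ g]

variable {a b a' b' : K} {φ : TorGen → ℕ → Kˣ}

theorem IsWeight.isBorel_matrix (hφ : IsWeight a b a' b' φ) (κ : K) (k : ℕ) :
    IsBorel a b φ (dualMatrix (BorelAlg.x a b φ) k (torDiff κ (BorelAlg.t a b φ) k))
      (torMatrix a b φ k) where
  serre := by
    refine SerreDer.isSerre_dualMatrix ?_ BorelAlg.isBorel.serre
    refine SerreDer.smul_sub ?_ ?_ κ <;>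
    exact (hφ.serre_f _).serreDer fun j => BorelAlg.isBorel.cross _ j
  tor :=
    { comm := fun g h => by
        simp [torMatrix, smul_smul, mul_comm, BorelAlg.isBorel.tor.comm g h]
      inv := fun p i => by
        simp [torMatrix, smul_smul, ← Units.val_mul, hφ.inv, BorelAlg.isBorel.tor.inv,
          Matrix.one_fin_two] }
  cross g j := by
    have h := (BorelAlg.isBorel (a := a) (b := b) (φ := φ)).tor.comm g
    by_cases hj : j = k
    · subst hj
      simp [torMatrix, dualMatrix, torDiff, BorelAlg.isBorel.cross, mul_sub, sub_mul, h]
    · simp [torMatrix, dualMatrix, hj, BorelAlg.isBorel.cross, smul_smul, mul_comm]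

/-- The matrix representation encoding the commutation of `e_k` with `BorelAlg`. -/
def IsWeight.matrixHom (hφ : IsWeight a b a' b' φ) (κ : K) (k : ℕ) :
    BorelAlg a b φ →ₐ[K] Matrix (Fin 2) (Fin 2) (BorelAlg a b φ) :=
  (hφ.isBorel_matrix κ k).lift

theorem IsWeight.matrixHom_lower (hφ : IsWeight a b a' b' φ) (κ : K) (k : ℕ)
    (y : BorelAlg a b φ) : hφ.matrixHom κ k y 1 0 = 0 ∧ hφ.matrixHom κ k y 1 1 = y := by
  refine matrix_lower_row _ BorelAlg.adjoin_gen ?_ y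
  rintro _ (⟨i, rfl⟩ | ⟨g, rfl⟩)
  · simp [matrixHom, dualMatrix]
  · simp [matrixHom, torMatrix]

/-- The endomorphism `τ_k` in the rule `e_k y = τ_k(y) e_k + δ_k(y)`. -/
def IsWeight.endo (hφ : IsWeight a b a' b' φ) (κ : K) (k : ℕ) :
    BorelAlg a b φ →ₐ[K] BorelAlg a b φ :=
  matrixEndo (hφ.matrixHom κ k) fun y => (hφ.matrixHom_lower κ k y).1

/-- The skew derivation `δ_k` in the rule `e_k y = τ_k(y) e_k + δ_k(y)`. -/
def IsWeight.der (hφ : IsWeight a b a' b' φ) (κ : K) (k : ℕ) :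
    BorelAlg a b φ →ₗ[K] BorelAlg a b φ :=
  matrixDer (hφ.matrixHom κ k)

theorem IsWeight.isSkewDer (hφ : IsWeight a b a' b' φ) (κ : K) (k : ℕ) :
    IsSkewDer (hφ.endo κ k) (hφ.der κ k) :=
  isSkewDer_matrixDer _ _ fun y => (hφ.matrixHom_lower κ k y).2

@[simp]
theorem IsWeight.endo_x (hφ : IsWeight a b a' b' φ) (κ : K) (k i : ℕ) :
    hφ.endo κ k (BorelAlg.x a b φ i) = BorelAlg.x a b φ i := by
  simp [endo, matrixEndo, matrixHom, dualMatrix]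

@[simp]
theorem IsWeight.endo_t (hφ : IsWeight a b a' b' φ) (κ : K) (k : ℕ) (g : TorGen) :
    hφ.endo κ k (BorelAlg.t a b φ g) = (φ g k : K) • BorelAlg.t a b φ g := by
  simp [endo, matrixEndo, matrixHom, torMatrix]

@[simp]
theorem IsWeight.der_x (hφ : IsWeight a b a' b' φ) (κ : K) (k i : ℕ) :
    hφ.der κ k (BorelAlg.x a b φ i) =
      if k = i then torDiff κ (BorelAlg.t a b φ) k else 0 := by
  simp [der, matrixDer, matrixHom, dualMatrix, eq_comm]

@[simp]
theorem IsWeight.der_t (hφ : IsWeight a b a' b' φ) (κ : K) (k : ℕ) (g : TorGen) :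
    hφ.der κ k (BorelAlg.t a b φ g) = 0 := by
  simp [der, matrixDer, matrixHom, torMatrix]

/-- The operator on `BorelAlg ⊗ SerreAlg` by which `e_k` acts. -/
def IsWeight.raise (hφ : IsWeight a b a' b' φ) (κ : K) (k : ℕ) :
    Module.End K (BorelAlg a b φ ⊗[K] SerreAlg a' b') :=
  oreOp (hφ.endo κ k) (hφ.der κ k) (SerreAlg.gen a' b' k)

theorem IsWeight.raise_mul_leftMul (hφ : IsWeight a b a' b' φ) (κ : K) (k : ℕ)
    (y : BorelAlg a b φ) :
    hφ.raise κ k * leftMul K _ _ y =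
      leftMul K _ _ (hφ.endo κ k y) * hφ.raise κ k + leftMul K _ _ (hφ.der κ k y) :=
  (hφ.isSkewDer κ k).oreOp_mul_leftMul _ _

theorem IsWeight.raise_mul_leftMul_x (hφ : IsWeight a b a' b' φ) (κ : K) (k j : ℕ) :
    hφ.raise κ k * leftMul K _ _ (BorelAlg.x a b φ j) =
      leftMul K _ (SerreAlg a' b') (BorelAlg.x a b φ j) * hφ.raise κ k +
        if k = j then torDiff κ (fun g => leftMul K _ (SerreAlg a' b') (BorelAlg.t a b φ g)) k
        else 0 := by
  rw [raise_mul_leftMul]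
  by_cases h : k = j <;> simp [h, torDiff]

theorem IsWeight.raise_mul_leftMul_t (hφ : IsWeight a b a' b' φ) (κ : K) (k : ℕ) (g : TorGen) :
    hφ.raise κ k * leftMul K _ _ (BorelAlg.t a b φ g) =
      (φ g k : K) • (leftMul K _ (SerreAlg a' b') (BorelAlg.t a b φ g) * hφ.raise κ k) := by
  simp [raise_mul_leftMul]

theorem IsWeight.lift_raise_one_tmul (hφ : IsWeight a b a' b' φ) (κ : K) (u : FreeAlgebra K ℕ)
    (y : SerreAlg a' b') :
    FreeAlgebra.lift K (hφ.raise κ) u ((1 : BorelAlg a b φ) ⊗ₜ[K] y) =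
      1 ⊗ₜ (FreeAlgebra.lift K (SerreAlg.gen a' b') u * y) := by
  induction u using FreeAlgebra.induction generalizing y with
  | grade0 k => simp [Algebra.algebraMap_eq_smul_one]
  | grade1 i =>
    rw [lift_ι_apply, lift_ι_apply]
    exact (hφ.isSkewDer κ i).oreOp_one_tmul (SerreAlg.gen a' b' i) y
  | mul u v hu hv => simp [hu, hv, mul_assoc]
  | add u v hu hv => simp [hu, hv, add_mul, TensorProduct.tmul_add]

/-- Conjugating by an operator that rescales a family preserves the Serre relations at a
vector. -/
theorem serre_apply_of_scale {V : Type*} [AddCommGroup V] [Module K V] {E : ℕ → Module.End K V}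
    {T : Module.End K V} {c : ℕ → K} (hT : ∀ i, E i * T = c i • (T * E i)) {m : V}
    ⦃u v : FreeAlgebra K ℕ⦄ (huv : SerreRel a b u v)
    (hm : FreeAlgebra.lift K E u m = FreeAlgebra.lift K E v m) :
    FreeAlgebra.lift K E u (T m) = FreeAlgebra.lift K E v (T m) := by
  have hT' : ∀ i m, E i (T m) = c i • T (E i m) := fun i m => by
    simpa using DFunLike.congr_fun (hT i) m
  replace hm := congrArg T hm
  cases huv with
  | far i j _ =>
    simp [hT'] at hm ⊢
    rw [hm, smul_comm]
  | left i =>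
    simp [hT'] at hm ⊢
    linear_combination (norm := module) (c i * c i * c (i + 1)) • hm
  | right i =>
    simp [hT'] at hm ⊢
    linear_combination (norm := module) (c i * c (i + 1) * c (i + 1)) • hm

theorem IsWeight.isSerre_raise (hφ : IsWeight a b a' b' φ) (κ : K) :
    IsSerre a' b' (hφ.raise κ) := by
  intro u v huv
  have hder : ∀ k, SerreDer a' b' (hφ.raise κ) k
      (torDiff κ (fun g => leftMul K _ _ (BorelAlg.t a b φ g)) k) := by
    intro k
    have h : ∀ p, SerreDer a' b' (hφ.raise κ) k
        (leftMul K _ _ (BorelAlg.t a b φ (TorGen.pos p k))) := fun p =>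
      (hφ.serre_e p).serreDer fun j => by simp [raise_mul_leftMul_t, smul_smul]
    exact (h false).smul_sub (h true) κ
  have key : ∀ (y : BorelAlg a b φ) (m : BorelAlg a b φ ⊗[K] SerreAlg a' b'),
      FreeAlgebra.lift K (hφ.raise κ) u m = FreeAlgebra.lift K (hφ.raise κ) v m →
      FreeAlgebra.lift K (hφ.raise κ) u (leftMul K _ _ y m) =
        FreeAlgebra.lift K (hφ.raise κ) v (leftMul K _ _ y m) := by
    intro y
    have hy : y ∈ Algebra.adjoin K
        (Set.range (BorelAlg.x a b φ) ∪ Set.range (BorelAlg.t a b φ)) := by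
      rw [BorelAlg.adjoin_gen]
      exact Algebra.mem_top
    induction hy using Algebra.adjoin_induction with
    | mem y hy =>
      intro m hm
      rcases hy with ⟨j, rfl⟩ | ⟨g, rfl⟩
      · have h := DFunLike.congr_fun ((hder j).commute_sub (fun i => by
          rw [hφ.raise_mul_leftMul_x κ i j]
          by_cases hij : i = j <;> simp [hij]) huv) m
        simpa [hm, sub_eq_zero] using h
      · exact serre_apply_of_scale (fun i => hφ.raise_mul_leftMul_t κ i g) huv hm
    | algebraMap k =>
      intro m hm
      simp [Algebra.algebraMap_eq_smul_one, hm]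
    | add x y _ _ hx hy =>
      intro m hm
      simp [hx m hm, hy m hm]
    | mul x y _ _ hx hy =>
      intro m hm
      simpa using hx _ (hy m hm)
  refine TensorProduct.ext' fun y z => ?_
  have := key y (1 ⊗ₜ z) (by
    rw [lift_raise_one_tmul, lift_raise_one_tmul, SerreAlg.isSerre_gen huv])
  simpa using this

theorem IsWeight.isQuantum (hφ : IsWeight a b a' b' φ) (κ : K) :
    IsQuantum a b a' b' κ φ
      (fun i => leftMul K _ (SerreAlg a' b') (BorelAlg.x a b φ i))
      (fun g => leftMul K _ (SerreAlg a' b') (BorelAlg.t a b φ g)) (hφ.raise κ) where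
  borel := BorelAlg.isBorel.map _
  serre := hφ.isSerre_raise κ
  cross_t := hφ.raise_mul_leftMul_t κ
  cross_f := hφ.raise_mul_leftMul_x κ

/-- Triangular decomposition of an algebra which is universal for the relations `IsQuantum`. -/
theorem IsWeight.mulMap_bijective (hφ : IsWeight a b a' b' φ) {κ : K} {U : Type*} [Ring U]
    [Algebra K U] {f : ℕ → U} {t : TorGen → U} {e : ℕ → U} (hU : IsQuantum a b a' b' κ φ f t e)
    (hgen : Algebra.adjoin K (Set.range f ∪ Set.range t ∪ Set.range e) = ⊤)
    (ρ : U →ₐ[K] Module.End K (BorelAlg a b φ ⊗[K] SerreAlg a' b'))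
    (hρf : ∀ i, ρ (f i) = leftMul K _ _ (BorelAlg.x a b φ i))
    (hρt : ∀ g, ρ (t g) = leftMul K _ _ (BorelAlg.t a b φ g))
    (hρe : ∀ i, ρ (e i) = hφ.raise κ i) :
    Function.Bijective (mulMap hU.borel.lift hU.serre.lift) := by
  refine _root_.mulMap_bijective _ _ (SerreAlg.gen a' b') (hφ.endo κ) (hφ.der κ)
    (hφ.isSkewDer κ) BorelAlg.adjoin_gen ?_ SerreAlg.adjoin_gen ?_ ρ ?_ ?_
  · rintro k _ (⟨j, rfl⟩ | ⟨g, rfl⟩)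
    · by_cases h : k = j <;> simp [hU.cross_f, h, torDiff]
    · simp [hU.cross_t]
  · rw [eq_top_iff, ← hgen]
    refine Algebra.adjoin_mono (Set.union_subset_union (Set.union_subset ?_ ?_) ?_)
    · rintro _ ⟨i, rfl⟩
      exact ⟨BorelAlg.x a b φ i, by simp⟩
    · rintro _ ⟨g, rfl⟩
      exact ⟨BorelAlg.t a b φ g, by simp⟩
    · rintro _ ⟨i, rfl⟩
      exact ⟨i, by simp⟩
  · intro y
    have : ρ.comp hU.borel.lift = leftMul K (BorelAlg a b φ) (SerreAlg a' b') :=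
      AlgHom.ext_of_adjoin_eq_top BorelAlg.adjoin_gen (by
        rintro _ (⟨j, rfl⟩ | ⟨g, rfl⟩) <;> simp [hρf, hρt])
    exact DFunLike.congr_fun this y
  · intro k
    simp [hρe, raise]

end Action

/-! ## The quantum group `U_{r,s}(sl_∞)` -/

section QuantumGroupDecomposition

open FreeAlgebra

/-- The generator of `U_{r,s}(sl_∞)` corresponding to a generator of the torus. -/
def TorGen.toQGen : TorGen → QGen
  | .pos false i => .w i
  | .pos true i => .w' i
  | .neg false i => .winv i
  | .neg true i => .w'inv i

theorem TorGen.toral_toQGen (g : TorGen) : g.toQGen.toral := by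
  rcases g with ⟨_ | _, i⟩ | ⟨_ | _, i⟩ <;> trivial

theorem QGen.exists_toQGen {q : QGen} (hq : q.toral) : ∃ g : TorGen, g.toQGen = q := by
  cases q with
  | e i => exact hq.elim
  | f i => exact hq.elim
  | w i => exact ⟨.pos false i, rfl⟩
  | winv i => exact ⟨.neg false i, rfl⟩
  | w' i => exact ⟨.pos true i, rfl⟩
  | w'inv i => exact ⟨.neg true i, rfl⟩

variable {K : Type} [Field K]

/-- The weights of `w_i`, `w'_i` on the `f_j`. -/
def qWeightPos (r s : Kˣ) : Bool → ℕ → ℕ → Kˣ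
  | false, i, j => r ^ (-bform j i) * s ^ bform i j
  | true, i, j => r ^ bform i j * s ^ (-bform j i)

/-- The weights of the toral generators on the `f_j`. -/
def qWeight (r s : Kˣ) : TorGen → ℕ → Kˣ
  | .pos p i, j => qWeightPos r s p i j
  | .neg p i, j => (qWeightPos r s p i j)⁻¹

theorem bform_self (i : ℕ) : bform i i = 1 := by simp [bform]

theorem bform_succ (i : ℕ) : bform i (i + 1) = -1 := by simp [bform]

theorem bform_succ_left (i : ℕ) : bform (i + 1) i = 0 := by
  rw [bform, if_neg (by omega), if_neg (by omega)]

theorem bform_far {i j : ℕ} (h : i + 1 < j ∨ j + 1 < i) : bform i j = 0 := by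
  rw [bform, if_neg (by omega), if_neg (by omega)]

theorem isWeight_qWeight (r s : Kˣ) :
    IsWeight ((r * s : K)⁻¹) ((r : K)⁻¹ + (s : K)⁻¹) (r * s : K) (r + s : K)
      (qWeight r s) where
  inv p i j := by simp [qWeight]
  serre_f p := by
    have hr := r.ne_zero
    have hs := s.ne_zero
    cases p <;> constructor <;> intro i <;>
      simp only [qWeight, qWeightPos, bform_self, bform_succ, bform_succ_left] <;>
      first
      | (intro j h; simp [bform_far h, bform_far h.symm])
      | (simp; try field_simp; try ring)
  serre_e p := by
    have hr := r.ne_zero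
    have hs := s.ne_zero
    cases p <;> constructor <;> intro i <;>
      simp only [qWeight, qWeightPos, bform_self, bform_succ, bform_succ_left] <;>
      first
      | (intro j h; simp [bform_far h, bform_far h.symm])
      | (simp; try field_simp; try ring)

variable (r s : Kˣ)

/-- A presentation of `U_{r,s}(sl_∞)` as a ring. -/
abbrev QPres : Type := Presented (QRel K r s)

/-- If `v` is inverse to `w`, then its weight is the inverse weight. -/
theorem inv_weight {A : Type*} [Ring A] [Algebra K A] {v w x : A} (h : w * v = 1) (h' : v * w = 1)
    {c : Kˣ} (hw : w * x = (c : K) • (x * w)) : v * x = ((c⁻¹ : Kˣ) : K) • (x * v) := by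
  have : x * v = (c : K) • (v * x) := by
    calc x * v = v * (w * x) * v := by rw [← mul_assoc, h', one_mul]
      _ = (c : K) • (v * x) := by
        rw [hw, mul_smul_comm, smul_mul_assoc, mul_assoc, mul_assoc x, h, mul_one]
  rw [this, smul_smul]
  simp

theorem isQuantum_gen :
    IsQuantum ((r * s : K)⁻¹) ((r : K)⁻¹ + (s : K)⁻¹) (r * s : K) (r + s : K)
      ((r - s : K)⁻¹) (qWeight r s)
      (fun i => Presented.of (QRel K r s) (QGen.f i))
      (fun g => Presented.of (QRel K r s) g.toQGen)
      (fun i => Presented.of (QRel K r s) (QGen.e i)) := by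
  have hcomm : ∀ g h : TorGen, Presented.of (QRel K r s) g.toQGen * .of _ h.toQGen =
      .of _ h.toQGen * .of _ g.toQGen := fun g h => by
    simpa using Presented.rel (QRel.tcomm (r := r) (s := s) _ _ g.toral_toQGen h.toral_toQGen)
  have hinv : ∀ p i, Presented.of (QRel K r s) (TorGen.pos p i).toQGen *
      .of _ (TorGen.neg p i).toQGen = 1 := fun p i => by
    cases p
    · simpa [TorGen.toQGen] using Presented.rel (QRel.winv1 (r := r) (s := s) i)
    · simpa [TorGen.toQGen] using Presented.rel (QRel.w'inv1 (r := r) (s := s) i)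
  have hinv' : ∀ p i, Presented.of (QRel K r s) (TorGen.neg p i).toQGen *
      .of _ (TorGen.pos p i).toQGen = 1 := fun p i => by rw [hcomm, hinv]
  have hf : ∀ p i j, Presented.of (QRel K r s) (TorGen.pos p i).toQGen * .of _ (QGen.f j) =
      (qWeightPos r s p i j : K) • (.of _ (QGen.f j) * .of _ (TorGen.pos p i).toQGen) :=
    fun p i j => by
    cases p
    · simpa only [map_mul, map_smul, lift_ι_apply, TorGen.toQGen, qWeightPos] using
        Presented.rel (QRel.wf (r := r) (s := s) i j)
    · simpa only [map_mul, map_smul, lift_ι_apply, TorGen.toQGen, qWeightPos] using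
        Presented.rel (QRel.w'f (r := r) (s := s) i j)
  have he : ∀ p i j, Presented.of (QRel K r s) (TorGen.pos p i).toQGen * .of _ (QGen.e j) =
      (((qWeightPos r s p i j)⁻¹ : Kˣ) : K) •
        (.of _ (QGen.e j) * .of _ (TorGen.pos p i).toQGen) :=
    fun p i j => by
    cases p
    · have := Presented.rel (QRel.we (r := r) (s := s) i j)
      simp only [map_mul, map_smul, lift_ι_apply] at this
      rw [qWeightPos, mul_inv, ← zpow_neg, ← zpow_neg, neg_neg]
      exact this
    · have := Presented.rel (QRel.w'e (r := r) (s := s) i j)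
      simp only [map_mul, map_smul, lift_ι_apply] at this
      rw [qWeightPos, mul_inv, ← zpow_neg, ← zpow_neg, neg_neg]
      exact this
  refine ⟨⟨?_, ⟨hcomm, hinv⟩, ?_⟩, ?_, ?_, ?_⟩
  · rintro _ _ (⟨i, j, h⟩ | i | i)
    · simpa using Presented.rel (QRel.ff (r := r) (s := s) i j h)
    · simpa only [map_mul, map_add, map_smul, lift_ι_apply] using
        Presented.rel (QRel.serre_f1 (r := r) (s := s) i)
    · simpa only [map_mul, map_add, map_smul, lift_ι_apply] using
        Presented.rel (QRel.serre_f2 (r := r) (s := s) i)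
  · rintro (⟨p, i⟩ | ⟨p, i⟩) j
    · exact hf p i j
    · exact inv_weight (hinv p i) (hinv' p i) (hf p i j)
  · rintro _ _ (⟨i, j, h⟩ | i | i)
    · simpa using Presented.rel (QRel.ee (r := r) (s := s) i j h)
    · simpa only [map_mul, map_add, map_smul, lift_ι_apply] using
        Presented.rel (QRel.serre_e1 (r := r) (s := s) i)
    · simpa only [map_mul, map_add, map_smul, lift_ι_apply] using
        Presented.rel (QRel.serre_e2 (r := r) (s := s) i)
  · rintro k (⟨p, i⟩ | ⟨p, i⟩)
    · rw [he, smul_smul]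
      simp [qWeight]
    · rw [inv_weight (hinv p i) (hinv' p i) (he p i k), smul_smul]
      simp [qWeight]
  · intro k j
    have := Presented.rel (QRel.ef (r := r) (s := s) k j)
    by_cases h : k = j
    · simpa [h, torDiff, TorGen.toQGen] using this
    · simpa [h] using this

/-- The assignment on generators determined by families `f`, `t`, `e`. -/
def qAssign {A : Type*} (f : ℕ → A) (t : TorGen → A) (e : ℕ → A) : QGen → A
  | .e i => e i
  | .f i => f i
  | .w i => t (.pos false i)
  | .winv i => t (.neg false i)
  | .w' i => t (.pos true i)
  | .w'inv i => t (.neg true i)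

@[simp]
theorem qAssign_toQGen {A : Type*} (f : ℕ → A) (t : TorGen → A) (e : ℕ → A) (g : TorGen) :
    qAssign f t e g.toQGen = t g := by
  rcases g with ⟨_ | _, i⟩ | ⟨_ | _, i⟩ <;> rfl

variable {r s}

theorem IsQuantum.lift_rel {A : Type*} [Ring A] [Algebra K A] {f : ℕ → A} {t : TorGen → A}
    {e : ℕ → A} (h : IsQuantum ((r * s : K)⁻¹) ((r : K)⁻¹ + (s : K)⁻¹) (r * s : K) (r + s : K)
      ((r - s : K)⁻¹) (qWeight r s) f t e) ⦃u v : FreeAlgebra K QGen⦄ (huv : QRel K r s u v) :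
    FreeAlgebra.lift K (qAssign f t e) u = FreeAlgebra.lift K (qAssign f t e) v := by
  cases huv with
  | tcomm x y hx hy =>
    obtain ⟨g, rfl⟩ := QGen.exists_toQGen hx
    obtain ⟨g', rfl⟩ := QGen.exists_toQGen hy
    simpa using h.borel.tor.comm g g'
  | winv1 i => simpa [qAssign] using h.borel.tor.inv false i
  | winv2 i => simpa [qAssign] using (h.borel.tor.comm _ _).trans (h.borel.tor.inv false i)
  | w'inv1 i => simpa [qAssign] using h.borel.tor.inv true i
  | w'inv2 i => simpa [qAssign] using (h.borel.tor.comm _ _).trans (h.borel.tor.inv true i)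
  | we i j =>
    have := h.cross_t' (.pos false i) j
    rw [qWeight, qWeightPos, mul_inv, ← zpow_neg, ← zpow_neg, neg_neg] at this
    simpa only [map_mul, map_smul, lift_ι_apply, qAssign] using this
  | w'e i j =>
    have := h.cross_t' (.pos true i) j
    rw [qWeight, qWeightPos, mul_inv, ← zpow_neg, ← zpow_neg, neg_neg] at this
    simpa only [map_mul, map_smul, lift_ι_apply, qAssign] using this
  | wf i j =>
    simpa only [map_mul, map_smul, lift_ι_apply, qAssign, qWeight, qWeightPos] using
      h.borel.cross (.pos false i) j
  | w'f i j =>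
    simpa only [map_mul, map_smul, lift_ι_apply, qAssign, qWeight, qWeightPos] using
      h.borel.cross (.pos true i) j
  | ef i j =>
    have := h.cross_f i j
    by_cases hij : i = j
    · simpa [hij, torDiff, qAssign] using this
    · simpa [hij, qAssign] using this
  | ee i j hij => simpa [qAssign] using h.serre (.far i j hij)
  | ff i j hij => simpa [qAssign] using h.borel.serre (.far i j hij)
  | serre_e1 i =>
    simpa only [map_mul, map_add, map_smul, lift_ι_apply, qAssign] using h.serre (.left i)
  | serre_e2 i =>
    simpa only [map_mul, map_add, map_smul, lift_ι_apply, qAssign] using h.serre (.right i)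
  | serre_f1 i =>
    simpa only [map_mul, map_add, map_smul, lift_ι_apply, qAssign] using h.borel.serre (.left i)
  | serre_f2 i =>
    simpa only [map_mul, map_add, map_smul, lift_ι_apply, qAssign] using h.borel.serre (.right i)

theorem QPres.mulMap_bijective :
    Function.Bijective (mulMap (isQuantum_gen r s).borel.lift (isQuantum_gen r s).serre.lift) := by
  have hφ := isWeight_qWeight r s
  refine hφ.mulMap_bijective (isQuantum_gen r s) ?_
    (Presented.lift (hφ.isQuantum _).lift_rel) ?_ ?_ ?_
  · rw [eq_top_iff, ← Presented.adjoin_of]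
    refine Algebra.adjoin_mono ?_
    rintro _ ⟨q, rfl⟩
    cases q with
    | e i => exact Or.inr ⟨i, rfl⟩
    | f i => exact Or.inl (Or.inl ⟨i, rfl⟩)
    | w i => exact Or.inl (Or.inr ⟨.pos false i, rfl⟩)
    | winv i => exact Or.inl (Or.inr ⟨.neg false i, rfl⟩)
    | w' i => exact Or.inl (Or.inr ⟨.pos true i, rfl⟩)
    | w'inv i => exact Or.inl (Or.inr ⟨.neg true i, rfl⟩)
  · intro i
    simp [qAssign]
  · intro g
    simp
  · intro i
    simp [qAssign]

end QuantumGroupDecomposition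

/-! ## Passing to subalgebras -/

section Subalgebra

variable {K U A B C : Type*} [CommRing K] [Semiring U] [Algebra K U] [Semiring A] [Algebra K A]
  [Semiring B] [Algebra K B] [Semiring C] [Algebra K C]

/-- A factorisation of `U` through algebra maps `i`, `j`, `k` descends to the images of these
maps. -/
theorem bijective_of_range_eq {P Q R : Subalgebra K U} {i : A →ₐ[K] U} {j : B →ₐ[K] U}
    {k : C →ₐ[K] U} (hi : i.range = P) (hj : j.range = Q) (hk : k.range = R)
    {m : (P ⊗[K] Q) ⊗[K] R →ₗ[K] U} (hm : ∀ p q r, m ((p ⊗ₜ q) ⊗ₜ r) = p * q * r)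
    {F : (A ⊗[K] B) ⊗[K] C →ₗ[K] U} (hF : ∀ a b c, F ((a ⊗ₜ b) ⊗ₜ c) = i a * j b * k c)
    (hbij : Function.Bijective F) : Function.Bijective m := by
  subst hi hj hk
  let θ : (A ⊗[K] B) ⊗[K] C →ₗ[K] (i.range ⊗[K] j.range) ⊗[K] k.range :=
    TensorProduct.map (TensorProduct.map i.rangeRestrict.toLinearMap j.rangeRestrict.toLinearMap)
      k.rangeRestrict.toLinearMap
  have hθ : Function.Surjective θ :=
    TensorProduct.map_surjective (TensorProduct.map_surjective i.rangeRestrict_surjective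
      j.rangeRestrict_surjective) k.rangeRestrict_surjective
  have hcomp : F = m ∘ₗ θ := TensorProduct.ext_threefold fun a b c => by simp [θ, hm, hF]
  rw [hcomp, LinearMap.coe_comp] at hbij
  exact ⟨Function.Injective.of_comp_right hbij.1 hθ, hbij.2.of_comp⟩

end Subalgebra

section QuantumGroupFactorisation

variable {K : Type} [Field K] (r s : Kˣ)

/-- The map from the algebra with the Serre relations of the `f_i` to `U_{r,s}(sl_∞)`. -/
def fHom : SerreAlg ((r * s : K)⁻¹) ((r : K)⁻¹ + (s : K)⁻¹) →ₐ[K] UQ K r s :=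
  (Presented.equivRingQuot (QRel K r s)).toAlgHom.comp (isQuantum_gen r s).borel.serre.lift

/-- The map from the torus to `U_{r,s}(sl_∞)`. -/
def tHom : TorAlg K →ₐ[K] UQ K r s :=
  (Presented.equivRingQuot (QRel K r s)).toAlgHom.comp ((isQuantum_gen r s).borel.tor.lift K)

/-- The map from the algebra with the Serre relations of the `e_i` to `U_{r,s}(sl_∞)`. -/
def eHom : SerreAlg (r * s : K) (r + s : K) →ₐ[K] UQ K r s :=
  (Presented.equivRingQuot (QRel K r s)).toAlgHom.comp (isQuantum_gen r s).serre.lift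

theorem range_fHom : (fHom r s).range = Algebra.adjoin K (Set.range fun i => Uf K r s i) := by
  rw [← Algebra.map_top, ← SerreAlg.adjoin_gen, AlgHom.map_adjoin, ← Set.range_comp]
  congr 2 with i
  simp [fHom, Presented.equivRingQuot_of, Uf]

theorem range_eHom : (eHom r s).range = Algebra.adjoin K (Set.range fun i => Ue K r s i) := by
  rw [← Algebra.map_top, ← SerreAlg.adjoin_gen, AlgHom.map_adjoin, ← Set.range_comp]
  congr 2 with i
  simp [eHom, Presented.equivRingQuot_of, Ue]

theorem tHom_gen (g : TorGen) :
    tHom r s (TorAlg.gen K g) = RingQuot.mkAlgHom K (QRel K r s) (FreeAlgebra.ι K g.toQGen) := by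
  simp [tHom, Presented.equivRingQuot_of]

theorem range_tHom : (tHom r s).range = Algebra.adjoin K
    (Set.range (fun i => Uw K r s i) ∪ Set.range (fun i => Uwinv K r s i) ∪
      Set.range (fun i => Uw' K r s i) ∪ Set.range (fun i => Uw'inv K r s i)) := by
  rw [← Algebra.map_top, ← TorAlg.adjoin_gen, AlgHom.map_adjoin, ← Set.range_comp]
  congr 1
  ext x
  constructor
  · rintro ⟨⟨_ | _, i⟩ | ⟨_ | _, i⟩, rfl⟩
    · exact Or.inl (Or.inl (Or.inl ⟨i, (tHom_gen r s (.pos false i)).symm⟩))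
    · exact Or.inl (Or.inr ⟨i, (tHom_gen r s (.pos true i)).symm⟩)
    · exact Or.inl (Or.inl (Or.inr ⟨i, (tHom_gen r s (.neg false i)).symm⟩))
    · exact Or.inr ⟨i, (tHom_gen r s (.neg true i)).symm⟩
  · rintro (((⟨i, rfl⟩ | ⟨i, rfl⟩) | ⟨i, rfl⟩) | ⟨i, rfl⟩)
    · exact ⟨.pos false i, tHom_gen r s _⟩
    · exact ⟨.neg false i, tHom_gen r s _⟩
    · exact ⟨.pos true i, tHom_gen r s _⟩
    · exact ⟨.neg true i, tHom_gen r s _⟩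

/-- The factorisation of `U_{r,s}(sl_∞)` in terms of abstractly presented algebras. -/
theorem exists_factorisation : ∃ F : (SerreAlg ((r * s : K)⁻¹) ((r : K)⁻¹ + (s : K)⁻¹) ⊗[K]
      TorAlg K) ⊗[K] SerreAlg (r * s : K) (r + s : K) →ₗ[K] UQ K r s,
    (∀ a b c, F ((a ⊗ₜ b) ⊗ₜ c) = fHom r s a * tHom r s b * eHom r s c) ∧
      Function.Bijective F := by
  let borel := LinearEquiv.ofBijective _
    (BorelAlg.mulMap_bijective (isWeight_qWeight r s).inv (a := ((r * s : K)⁻¹))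
      (b := (r : K)⁻¹ + (s : K)⁻¹))
  let total := LinearEquiv.ofBijective _ (QPres.mulMap_bijective (r := r) (s := s))
  let F := (TensorProduct.congr borel (LinearEquiv.refl K (SerreAlg (r * s : K) (r + s : K)))).trans
    (total.trans (Presented.equivRingQuot (QRel K r s)).toLinearEquiv)
  have hf : ∀ a, (isQuantum_gen r s).borel.lift (BorelAlg.isBorel.serre.lift a) =
      (isQuantum_gen r s).borel.serre.lift a := fun a => DFunLike.congr_fun
    (AlgHom.ext_of_adjoin_eq_top SerreAlg.adjoin_gen (by rintro _ ⟨i, rfl⟩; simp) :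
      (isQuantum_gen r s).borel.lift.comp BorelAlg.isBorel.serre.lift =
        (isQuantum_gen r s).borel.serre.lift) a
  have ht : ∀ b, (isQuantum_gen r s).borel.lift (BorelAlg.isBorel.tor.lift K b) =
      (isQuantum_gen r s).borel.tor.lift K b := fun b => DFunLike.congr_fun
    (AlgHom.ext_of_adjoin_eq_top TorAlg.adjoin_gen (by rintro _ ⟨i, rfl⟩; simp) :
      (isQuantum_gen r s).borel.lift.comp (BorelAlg.isBorel.tor.lift K) =
        (isQuantum_gen r s).borel.tor.lift K) b
  refine ⟨F.toLinearMap, fun a b c => ?_, F.bijective⟩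
  simp [F, borel, total, fHom, tHom, eHom, hf, ht]

end QuantumGroupFactorisation

end

set_option synthInstance.maxHeartbeats 1000000
set_option maxHeartbeats 2000000

noncomputable section

/-- The subalgebra `U⁻_{r,s}(sl_∞)` generated by the `f_i`. -/
def Uminus : Subalgebra KK (UQ KK rU sU) :=
  Algebra.adjoin KK (Set.range fun i => Uf KK rU sU i)

/-- The subalgebra `U⁰_{r,s}(sl_∞)` generated by the `w_i^{±1}, w'_i^{±1}`. -/
def Uzero : Subalgebra KK (UQ KK rU sU) :=
  Algebra.adjoin KK
    (Set.range (fun i => Uw KK rU sU i) ∪ Set.range (fun i => Uwinv KK rU sU i) ∪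
      Set.range (fun i => Uw' KK rU sU i) ∪ Set.range (fun i => Uw'inv KK rU sU i))

/-- The subalgebra `U⁺_{r,s}(sl_∞)` generated by the `e_i`. -/
def Uplus : Subalgebra KK (UQ KK rU sU) :=
  Algebra.adjoin KK (Set.range fun i => Ue KK rU sU i)

/-- The trilinear multiplication map `U⁻ × U⁰ × U⁺ → U`, `(a, b, c) ↦ a b c`. -/
def triMulAux :
    ↥Uminus →ₗ[KK] ↥Uzero →ₗ[KK] ↥Uplus →ₗ[KK] UQ KK rU sU :=
  ((((LinearMap.mul KK (UQ KK rU sU)).compr₂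
        (LinearMap.mul KK (UQ KK rU sU))).comp
      (Subalgebra.val Uminus).toLinearMap).compl₂
    (Subalgebra.val Uzero).toLinearMap).compr₂
      (LinearMap.lcomp KK (UQ KK rU sU) (Subalgebra.val Uplus).toLinearMap)

/-- The multiplication map `U⁻ ⊗ U⁰ ⊗ U⁺ → U` as a linear map on the tensor product. -/
def triMul : (↥Uminus ⊗[KK] ↥Uzero) ⊗[KK] ↥Uplus →ₗ[KK] UQ KK rU sU :=
  TensorProduct.lift (TensorProduct.lift triMulAux)

/-- Triangular decomposition: the multiplication map induces an isomorphism
of `ℚ(r,s)`-vector spaces `U⁻_{r,s}(sl_∞) ⊗ U⁰_{r,s}(sl_∞) ⊗ U⁺_{r,s}(sl_∞) ≅ U_{r,s}(sl_∞)`. -/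
theorem triangular_decomposition : Function.Bijective triMul := by
  obtain ⟨F, hF, hbij⟩ := exists_factorisation rU sU
  exact bijective_of_range_eq (range_fHom rU sU) (range_tHom rU sU) (range_eHom rU sU)
    (fun _ _ _ => rfl) hF hbij

end
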